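/- arXiv:1509.07558 — 2 statements merged into one kernel-verified Lean document; each statement's English description precedes it below -/
import Mathlib

section
/- For every c ∈ ℂ, every n ≥ 2 and all integers 1 ≤ j < l ≤ n−1: ∑_{ε ∈ {0,1}ⁿ} Re(c·u(ε)^{2^j}) · Re(c·u(ε)^{2^l}) = 0. -/
open Complex Finset Asymptotics Filter

noncomputable section

/-- The fixed point `α = (1 + (1-4c)^{1/2})/2` of `z ↦ z² + c`,
using the principal square root. -/
def alphaFix (c : ℂ) : ℂ := (1 + (1 - 4 * c) ^ ((1 : ℂ) / 2)) / 2

/-- `Q(ε) = εₙ + ε_{n-1}/2 + ⋯ + ε₁/2^{n-1}` for a word `ε` of length `n`,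
where `ε i` encodes the letter `ε_{i+1}`. A word of length `k ≤ n` is represented
by the same function, so `ε|_k` is obtained by replacing `n` with `k`. -/
def Qw (n : ℕ) (ε : ℕ → Fin 2) : ℝ :=
  ∑ i ∈ Finset.range n, (ε i : ℝ) / 2 ^ (n - 1 - i)

/-- `u(ε) = exp(-Q(ε)·π·i)`. -/
def uw (n : ℕ) (ε : ℕ → Fin 2) : ℂ :=
  Complex.exp (((-(Qw n ε) * Real.pi : ℝ) : ℂ) * Complex.I)

/-- The recursively defined quantity `r(ε)`:
`r(ε₁) = ½ Log(α - c)` and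
`r(ε₁…ε_k) = ½ r(ε₁…ε_{k-1}) + ½ Log(1 - c/ξ(ε₁…ε_{k-1}))`,
where `ξ(ε) = exp(Q(ε)·π·i + r(ε))` and `Log` is the principal logarithm. -/
def rmap (c : ℂ) : ℕ → (ℕ → Fin 2) → ℂ
  | 0, _ => 0
  | 1, _ => (1 / 2 : ℂ) * Complex.log (alphaFix c - c)
  | (k + 2), ε =>
      (1 / 2 : ℂ) * rmap c (k + 1) ε +
        (1 / 2 : ℂ) * Complex.log (1 - c /
          Complex.exp (((Qw (k + 1) ε * Real.pi : ℝ) : ℂ) * Complex.I + rmap c (k + 1) ε))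

/-- `ξ(ε) = exp(Q(ε)·π·i + r(ε))`. -/
def xiw (c : ℂ) (n : ℕ) (ε : ℕ → Fin 2) : ℂ :=
  Complex.exp (((Qw n ε * Real.pi : ℝ) : ℂ) * Complex.I + rmap c n ε)

/-- Extend a word of length `n` (a function `Fin n → Fin 2`) to a function `ℕ → Fin 2`. -/
def extw (n : ℕ) (ε : Fin n → Fin 2) : ℕ → Fin 2 :=
  fun i => if h : i < n then ε ⟨i, h⟩ else 0

/-- `Φₙ(w) = ∑_{j=1}^{n} (1 - 2^{-j}) w^{2^j}`. -/
def Phiw (n : ℕ) (w : ℂ) : ℂ :=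
  ∑ j ∈ Finset.Icc 1 n, (1 - (1 : ℂ) / 2 ^ j) * w ^ (2 ^ j)

/-- `Q` of an extended word as a sum over the letters of the word. -/
lemma Qw_extw (n : ℕ) (ε : Fin n → Fin 2) :
    Qw n (extw n ε) = ∑ i : Fin n, (ε i : ℝ) / 2 ^ (n - 1 - (i : ℕ)) := by
  simp [Qw, extw, Finset.sum_range]

/-- Flipping the letter with weight `2⁻ʲ` changes `Q` by `±2⁻ʲ`. -/
lemma Qw_extw_flip (n j : ℕ) (hj : j < n) (ε : Fin n → Fin 2) :
    ∃ s : ℝ, (s = 1 ∨ s = -1) ∧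
      Qw n (extw n (ε + Pi.single ⟨n - 1 - j, by omega⟩ 1)) =
        Qw n (extw n ε) + s / 2 ^ j := by
  set a : Fin n := ⟨n - 1 - j, by omega⟩ with ha
  have hw : n - 1 - (a : ℕ) = j := by simp only [ha]; omega
  refine ⟨((ε a + 1 : Fin 2) : ℝ) - (ε a : ℝ), ?_, ?_⟩
  · generalize ε a = x
    fin_cases x <;> simp
  · rw [Qw_extw, Qw_extw, ← sub_eq_iff_eq_add', ← Finset.sum_sub_distrib,
      Finset.sum_eq_single a]
    · simp only [Pi.add_apply, Pi.single_eq_same, hw]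
      ring
    · intro b _ hb
      simp [Pi.single_eq_of_ne hb]
    · simp

/-- Flipping the letter with weight `2⁻ʲ` changes the sign of `u ^ 2ʲ`. -/
lemma uw_extw_flip_pow (n j : ℕ) (hj : j < n) (ε : Fin n → Fin 2) :
    uw n (extw n (ε + Pi.single ⟨n - 1 - j, by omega⟩ 1)) ^ 2 ^ j =
      -uw n (extw n ε) ^ 2 ^ j := by
  obtain ⟨s, hs, hQ⟩ := Qw_extw_flip n j hj ε
  have hexp : Complex.exp (-(s * Real.pi * Complex.I)) = -1 := by
    rcases hs with rfl | rfl
    · simp [Complex.exp_neg]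
    · simp
  rw [uw, uw, hQ, ← Complex.exp_nat_mul, ← Complex.exp_nat_mul, ← neg_one_mul (cexp _), ← hexp,
    ← Complex.exp_add]
  congr 1
  push_cast
  field_simp
  ring

theorem stmt10 (c : ℂ) (n : ℕ) (hn : 2 ≤ n) (j l : ℕ)
    (hj : 1 ≤ j) (hjl : j < l) (hl : l ≤ n - 1) :
    ∑ ε : Fin n → Fin 2,
      (c * (uw n (extw n ε)) ^ (2 ^ j)).re * (c * (uw n (extw n ε)) ^ (2 ^ l)).re = 0 := by
  have hjn : j < n := by omega
  set F : (Fin n → Fin 2) → ℝ := fun ε =>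
    (c * (uw n (extw n ε)) ^ (2 ^ j)).re * (c * (uw n (extw n ε)) ^ (2 ^ l)).re with hF
  set e : Fin n → Fin 2 := Pi.single ⟨n - 1 - j, by omega⟩ 1 with he
  have hflip : ∀ ε, F (ε + e) = -F ε := by
    intro ε
    have h := uw_extw_flip_pow n j hjn ε
    have hl' : 2 ^ l = 2 ^ j * 2 ^ (l - j) := by
      rw [← pow_add]
      congr 1
      omega
    have heven : Even (2 ^ (l - j)) := even_two.pow_of_ne_zero (by omega)
    simp only [hF, he, hl', pow_mul, h, heven.neg_pow, mul_neg, neg_mul, Complex.neg_re]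
  have hsum : ∑ ε, F (ε + e) = ∑ ε, F ε := Equiv.sum_comp (Equiv.addRight e) F
  simp only [hflip, Finset.sum_neg_distrib] at hsum
  linarith

end
end

section
/- For every c ∈ ℂ and every n ≥ 1: ∑_{ε ∈ {0,1}ⁿ} Re(c·Φₙ(u(ε))) = (2ⁿ − 1)·Re(c). -/
open Complex Finset Asymptotics Filter

noncomputable section

/-- A power of `u(ε)` splits as a product over the letters of `ε`. -/
lemma uw_extw_pow (n j : ℕ) (ε : Fin n → Fin 2) :
    uw n (extw n ε) ^ 2 ^ j =
      ∏ i : Fin n,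
        Complex.exp (-((ε i : ℕ) : ℂ) * (2 ^ j / 2 ^ (n - 1 - (i : ℕ))) * (Real.pi * Complex.I)) := by
  rw [uw, ← Complex.exp_nat_mul, ← Complex.exp_sum, Qw, Finset.sum_range]
  congr 1
  push_cast
  rw [← Finset.sum_neg_distrib, Finset.sum_mul, Finset.sum_mul, Finset.mul_sum]
  refine Finset.sum_congr rfl fun i _ => ?_
  simp only [extw, i.isLt, dif_pos, Fin.eta]
  ring

/-- The power sums of the `u(ε)` over all words `ε` of length `n` factor over the letters. -/
lemma sum_uw_extw_pow (n j : ℕ) :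
    ∑ ε : Fin n → Fin 2, uw n (extw n ε) ^ 2 ^ j =
      ∏ i : Fin n,
        (1 + Complex.exp (-(2 ^ j / 2 ^ (n - 1 - (i : ℕ))) * (Real.pi * Complex.I))) := by
  simp_rw [uw_extw_pow]
  rw [← Fintype.prod_sum fun (i : Fin n) (a : Fin 2) =>
    Complex.exp (-((a : ℕ) : ℂ) * (2 ^ j / 2 ^ (n - 1 - (i : ℕ))) * (Real.pi * Complex.I))]
  simp [Fin.sum_univ_two]

lemma sum_uw_extw_pow_of_lt {n j : ℕ} (h : j < n) :
    ∑ ε : Fin n → Fin 2, uw n (extw n ε) ^ 2 ^ j = 0 := by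
  rw [sum_uw_extw_pow]
  refine Finset.prod_eq_zero (Finset.mem_univ (⟨n - 1 - j, by omega⟩ : Fin n)) ?_
  have hj : n - 1 - (n - 1 - j) = j := by omega
  simp [hj, Complex.exp_neg]

lemma sum_uw_extw_pow_self (n : ℕ) :
    ∑ ε : Fin n → Fin 2, uw n (extw n ε) ^ 2 ^ n = 2 ^ n := by
  rw [sum_uw_extw_pow]
  have key (i : Fin n) :
      Complex.exp (-((2 : ℂ) ^ n / 2 ^ (n - 1 - (i : ℕ))) * (Real.pi * Complex.I)) = 1 := by
    have hi : n = (n - 1 - (i : ℕ)) + ((i : ℕ) + 1) := by omega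
    have hpow : (2 : ℂ) ^ n / 2 ^ (n - 1 - (i : ℕ)) = 2 ^ ((i : ℕ) + 1) := by
      rw [div_eq_iff (by simp), ← pow_add, add_comm, ← hi]
    rw [hpow, Complex.exp_eq_one_iff]
    exact ⟨-2 ^ (i : ℕ), by push_cast; ring⟩
  simp only [key, Finset.prod_const, Finset.card_univ, Fintype.card_fin]
  norm_num

lemma sum_Phiw_uw_extw {n : ℕ} (hn : 1 ≤ n) :
    ∑ ε : Fin n → Fin 2, Phiw n (uw n (extw n ε)) = 2 ^ n - 1 := by
  simp only [Phiw]
  rw [Finset.sum_comm]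
  simp_rw [← Finset.mul_sum]
  rw [Finset.sum_eq_single_of_mem n (Finset.mem_Icc.2 ⟨hn, le_rfl⟩), sum_uw_extw_pow_self]
  · field_simp
  · intro j hj hjn
    rw [sum_uw_extw_pow_of_lt (lt_of_le_of_ne (Finset.mem_Icc.1 hj).2 hjn), mul_zero]

theorem stmt12 (c : ℂ) (n : ℕ) (hn : 1 ≤ n) :
    ∑ ε : Fin n → Fin 2, (c * Phiw n (uw n (extw n ε))).re = (2 ^ n - 1) * c.re := by
  rw [← Complex.re_sum, ← Finset.mul_sum, sum_Phiw_uw_extw hn]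
  have h : ((2 : ℂ) ^ n - 1) = ((2 ^ n - 1 : ℝ) : ℂ) := by push_cast; rfl
  rw [h, Complex.re_mul_ofReal, mul_comm]

end
end
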